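/- arXiv:2305.00645 — 3 statements merged into one kernel-verified Lean document; each statement's English description precedes it below -/
import Mathlib

section
/- Privacy of a single party's view in 2-out-of-3 replicated secret sharing over ℤ_{2^l}: for every natural number l and every secret x : ZMod (2^l), if the pair (x1, x2) is drawn uniformly at random from ZMod (2^l) × ZMod (2^l) and x3 is defined as x − x1 − x2, then each of the three pairs of shares held by a single party is exactly uniformly distributed; formally, the pushforward of the uniform probability mass function on ZMod (2^l) × ZMod (2^l) under each of the three maps p ↦ (p.1, p.2), p ↦ (p.2, x − p.1 − p.2), and p ↦ (x − p.1 − p.2, p.1) equals the uniform probability mass function on ZMod (2^l) × ZMod (2^l). In particular, each party's view is independent of the secret x. -/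
/-- The pushforward of a uniform distribution along a bijection is uniform. -/
theorem PMF.map_uniformOfFintype_of_bijective {α β : Type*} [Fintype α] [Nonempty α]
    [Fintype β] [Nonempty β] {f : α → β} (hf : Function.Bijective f) :
    (PMF.uniformOfFintype α).map f = PMF.uniformOfFintype β := by
  ext b
  obtain ⟨a, rfl⟩ := hf.surjective b
  rw [PMF.map_apply, tsum_eq_single a]
  · simp [Fintype.card_of_bijective hf]
  · intro a' ha'
    exact if_neg fun h => ha' (hf.injective h).symm

/-- Privacy of a single party's view in 2-out-of-3 replicated secret sharing
over `ℤ_{2^l}`: each party's pair of shares is uniformly distributed,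
independently of the secret `x`. -/
theorem rss_single_view_uniform (l : ℕ) (x : ZMod (2 ^ l)) :
    ((PMF.uniformOfFintype (ZMod (2 ^ l) × ZMod (2 ^ l))).map
        (fun p => (p.1, p.2)) =
      PMF.uniformOfFintype (ZMod (2 ^ l) × ZMod (2 ^ l))) ∧
    ((PMF.uniformOfFintype (ZMod (2 ^ l) × ZMod (2 ^ l))).map
        (fun p => (p.2, x - p.1 - p.2)) =
      PMF.uniformOfFintype (ZMod (2 ^ l) × ZMod (2 ^ l))) ∧
    ((PMF.uniformOfFintype (ZMod (2 ^ l) × ZMod (2 ^ l))).map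
        (fun p => (x - p.1 - p.2, p.1)) =
      PMF.uniformOfFintype (ZMod (2 ^ l) × ZMod (2 ^ l))) := by
  refine ⟨PMF.map_id _, ?_, ?_⟩ <;>
    refine PMF.map_uniformOfFintype_of_bijective (Finite.injective_iff_bijective.mp ?_)
  · rintro ⟨a, b⟩ ⟨c, d⟩ h
    obtain ⟨rfl, h⟩ := Prod.mk.inj h
    simpa using h
  · rintro ⟨a, b⟩ ⟨c, d⟩ h
    obtain ⟨h, rfl⟩ := Prod.mk.inj h
    simpa using h
end

section
/- Privacy of XOR-based Boolean sharing: for every width w and every secret x : BitVec w, if the pair (x1, x2) is drawn uniformly at random from BitVec w × BitVec w and x3 is defined as x ^^^ x1 ^^^ x2 (bitwise XOR), then each of the three pairs (x1, x2), (x2, x3), and (x3, x1) is exactly uniformly distributed; formally, the pushforward of the uniform probability mass function on BitVec w × BitVec w under each of the maps p ↦ (p.1, p.2), p ↦ (p.2, x ^^^ p.1 ^^^ p.2), and p ↦ (x ^^^ p.1 ^^^ p.2, p.1) equals the uniform probability mass function on BitVec w × BitVec w. -/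
/-- `BitVec w` is a finite type, via its defining equivalence with `Fin (2 ^ w)`. -/
instance bitVecFintype (w : ℕ) : Fintype (BitVec w) :=
  Fintype.ofEquiv (Fin (2 ^ w))
    ⟨BitVec.ofFin, BitVec.toFin, fun _ => rfl, fun _ => rfl⟩

/-- A self-map of a finite type that is injective preserves the uniform distribution. -/
theorem PMF.map_uniformOfFintype_of_injective {α : Type*} [Fintype α] [Nonempty α] {f : α → α}
    (hf : Function.Injective f) :
    (PMF.uniformOfFintype α).map f = PMF.uniformOfFintype α := by
  classical
  ext b
  obtain ⟨a, rfl⟩ := Finite.surjective_of_injective hf b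
  simp only [PMF.map_apply, PMF.uniformOfFintype_apply, hf.eq_iff, eq_comm (a := a), tsum_ite_eq]

/-- Privacy of XOR-based Boolean sharing: each of the three pairs of shares
held by a single party is exactly uniformly distributed. -/
theorem xor_sharing_single_view_uniform (w : ℕ) (x : BitVec w) :
    ((PMF.uniformOfFintype (BitVec w × BitVec w)).map
        (fun p => (p.1, p.2)) =
      PMF.uniformOfFintype (BitVec w × BitVec w)) ∧
    ((PMF.uniformOfFintype (BitVec w × BitVec w)).map
        (fun p => (p.2, x ^^^ p.1 ^^^ p.2)) =
      PMF.uniformOfFintype (BitVec w × BitVec w)) ∧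
    ((PMF.uniformOfFintype (BitVec w × BitVec w)).map
        (fun p => (x ^^^ p.1 ^^^ p.2, p.1)) =
      PMF.uniformOfFintype (BitVec w × BitVec w)) := by
  refine ⟨PMF.map_uniformOfFintype_of_injective ?_, PMF.map_uniformOfFintype_of_injective ?_,
    PMF.map_uniformOfFintype_of_injective ?_⟩
  · exact fun _ _ h => h
  · rintro ⟨a, b⟩ ⟨c, d⟩ h
    obtain ⟨rfl, h⟩ := Prod.mk.inj h
    rw [BitVec.xor_left_inj, BitVec.xor_right_inj] at h
    exact Prod.ext h rfl
  · rintro ⟨a, b⟩ ⟨c, d⟩ h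
    obtain ⟨h, rfl⟩ := Prod.mk.inj h
    rw [BitVec.xor_right_inj] at h
    exact Prod.ext rfl h
end

section
/- Correctness and privacy of pairwise zero-sharing for re-sharing: for every natural number l and all s1, s2, s3 : ZMod (2^l), the values α1 = s1 − s2, α2 = s2 − s3, α3 = s3 − s1 satisfy α1 + α2 + α3 = 0; moreover, for every fixed z : ZMod (2^l), if s1, s2, s3 are independent and uniform on ZMod (2^l), then the blinded value z + α1 is exactly uniformly distributed on ZMod (2^l) (formally, the pushforward of the uniform probability mass function on ZMod (2^l) × ZMod (2^l) × ZMod (2^l) under the map s ↦ z + s.1 − s.2.1 equals the uniform probability mass function on ZMod (2^l)), and likewise for z + α2 and z + α3. -/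
theorem PMF.eq_uniformOfFintype_of_forall_eq {α : Type*} [Fintype α] [Nonempty α] (p : PMF α)
    (h : ∀ a b, p a = p b) : p = PMF.uniformOfFintype α := by
  ext a
  have hsum : ∑ b, p b = 1 := (tsum_fintype p).symm.trans p.tsum_coe
  rw [Finset.sum_congr rfl fun b _ => h b a, Finset.sum_const, Finset.card_univ,
    nsmul_eq_mul, mul_comm] at hsum
  rw [PMF.uniformOfFintype_apply]
  exact ENNReal.eq_inv_of_mul_eq_one_left hsum

/-- If the fibres of `f` are permuted transitively by permutations of the domain, then `f` maps
the uniform distribution to the uniform distribution. -/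
theorem PMF.map_uniformOfFintype_of_exists_perm {α β : Type*} [Fintype α] [Nonempty α]
    [Fintype β] [Nonempty β] (f : α → β)
    (h : ∀ a b, ∃ e : Equiv.Perm α, ∀ x, b = f (e x) ↔ a = f x) :
    (PMF.uniformOfFintype α).map f = PMF.uniformOfFintype β := by
  classical
  refine PMF.eq_uniformOfFintype_of_forall_eq _ fun a b => ?_
  obtain ⟨e, he⟩ := h a b
  rw [PMF.map_apply, PMF.map_apply, ← e.tsum_eq (fun x => if b = f x then _ else _)]
  simp only [he, PMF.uniformOfFintype_apply]

/-- If translating the argument by `v g` translates the value of `f` by `g`, then `f` maps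
the uniform distribution to the uniform distribution. -/
theorem PMF.map_uniformOfFintype_of_map_add {A G : Type*} [AddGroup A] [Fintype A]
    [AddCommGroup G] [Fintype G] (f : A → G) (v : G → A) (h : ∀ x g, f (x + v g) = f x + g) :
    (PMF.uniformOfFintype A).map f = PMF.uniformOfFintype G := by
  refine PMF.map_uniformOfFintype_of_exists_perm f fun a b =>
    ⟨Equiv.addRight (v (b - a)), fun x => ?_⟩
  rw [Equiv.coe_addRight, h, ← sub_eq_iff_eq_add, sub_sub_cancel]


/-- Correctness and privacy of pairwise zero-sharing for re-sharing: the
pairwise differences sum to zero, and each blinded value `z + αᵢ` is exactly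
uniformly distributed when the pairwise seeds are uniform. -/
theorem pairwise_zero_sharing (l : ℕ) :
    (∀ s1 s2 s3 : ZMod (2 ^ l), (s1 - s2) + (s2 - s3) + (s3 - s1) = 0) ∧
    (∀ z : ZMod (2 ^ l),
      ((PMF.uniformOfFintype (ZMod (2 ^ l) × ZMod (2 ^ l) × ZMod (2 ^ l))).map
          (fun s => z + s.1 - s.2.1) =
        PMF.uniformOfFintype (ZMod (2 ^ l))) ∧
      ((PMF.uniformOfFintype (ZMod (2 ^ l) × ZMod (2 ^ l) × ZMod (2 ^ l))).map
          (fun s => z + s.2.1 - s.2.2) =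
        PMF.uniformOfFintype (ZMod (2 ^ l))) ∧
      ((PMF.uniformOfFintype (ZMod (2 ^ l) × ZMod (2 ^ l) × ZMod (2 ^ l))).map
          (fun s => z + s.2.2 - s.1) =
        PMF.uniformOfFintype (ZMod (2 ^ l)))) := by
  refine ⟨fun s1 s2 s3 => by ring, fun z => ⟨?_, ?_, ?_⟩⟩
  · refine PMF.map_uniformOfFintype_of_map_add _ (fun g => (g, 0, 0)) fun s g => ?_
    simp only [Prod.fst_add, Prod.snd_add]
    ring
  · refine PMF.map_uniformOfFintype_of_map_add _ (fun g => (0, g, 0)) fun s g => ?_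
    simp only [Prod.fst_add, Prod.snd_add]
    ring
  · refine PMF.map_uniformOfFintype_of_map_add _ (fun g => (0, 0, g)) fun s g => ?_
    simp only [Prod.fst_add, Prod.snd_add]
    ring
end
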